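/- arXiv:2605.04805 — 4 statements merged into one kernel-verified Lean document; each statement's English description precedes it below -/
import Mathlib

section
/- Let U ⊆ ℝ² be an open set, let λ₁, …, λₙ : U → ℝ be differentiable functions with Σ_{i=1}^n λ_i(x) = 1 for all x ∈ U, let a₁, …, aₙ ∈ ℝ², and define F : U → ℝ² by F(x) = Σ_{i=1}^n λ_i(x) a_i. Then for every x ∈ U, the Jacobian determinant of F satisfies det(DF(x)) = 2 Σ_{1 ≤ i < j < k ≤ n} D(λ_i, λ_j, λ_k)(x) · A(a_i, a_j, a_k). -/
noncomputable section

/-- The Euclidean plane. -/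
abbrev E2 : Type := EuclideanSpace ℝ (Fin 2)

/-- `D(f,g,h)(x)`: the determinant of the 3×3 matrix whose rows are
`(f x, g x, h x)`, `(∂₁f x, ∂₁g x, ∂₁h x)`, `(∂₂f x, ∂₂g x, ∂₂h x)`. -/
def Dop (f g h : E2 → ℝ) (x : E2) : ℝ :=
  Matrix.det
    !![f x, g x, h x;
       fderiv ℝ f x (EuclideanSpace.single 0 1), fderiv ℝ g x (EuclideanSpace.single 0 1),
         fderiv ℝ h x (EuclideanSpace.single 0 1);
       fderiv ℝ f x (EuclideanSpace.single 1 1), fderiv ℝ g x (EuclideanSpace.single 1 1),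
         fderiv ℝ h x (EuclideanSpace.single 1 1)]

/-- `A(u,v,w)`: the signed area of the triangle `(u, v, w)`. -/
def areaA (u v w : E2) : ℝ :=
  (1 / 2) * Matrix.det !![(1 : ℝ), 1, 1; u 0, v 0, w 0; u 1, v 1, w 1]

/-- The 2×2 Jacobian matrix of a map `F : ℝ² → ℝ²` at `x`. -/
def jac (F : E2 → E2) (x : E2) : Matrix (Fin 2) (Fin 2) ℝ :=
  Matrix.of fun r s : Fin 2 => fderiv ℝ (fun y => F y r) x (EuclideanSpace.single s 1)

/-- A sum over all triples of a function vanishing on triples with a repeated entry is the sum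
over increasing triples of its symmetrization. -/
theorem sum_triple_eq_sum_increasing {ι : Type*} [Fintype ι] [LinearOrder ι] (G : ι → ι → ι → ℝ)
    (h12 : ∀ i k, G i i k = 0) (h13 : ∀ i j, G i j i = 0) (h23 : ∀ i j, G i j j = 0) :
    ∑ i, ∑ j, ∑ k, G i j k =
      ∑ i, ∑ j, ∑ k, if i < j ∧ j < k then
        G i j k + G i k j + G j i k + G j k i + G k i j + G k j i else 0 := by
  have swap12 (H : ι → ι → ι → ℝ) : ∑ i, ∑ j, ∑ k, H i j k = ∑ i, ∑ j, ∑ k, H j i k :=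
    Finset.sum_comm
  have swap23 (H : ι → ι → ι → ℝ) : ∑ i, ∑ j, ∑ k, H i j k = ∑ i, ∑ j, ∑ k, H i k j :=
    Finset.sum_congr rfl fun _ _ => Finset.sum_comm
  let T (H : ι → ι → ι → ℝ) (i j k : ι) : ℝ := if i < j ∧ j < k then H i j k else 0
  have split (i j k : ι) : G i j k = T G i j k + T (fun i k j => G i j k) i k j
      + T (fun j i k => G i j k) j i k + T (fun j k i => G i j k) j k i
      + T (fun k i j => G i j k) k i j + T (fun k j i => G i j k) k j i := by
    simp only [T]
    rcases lt_trichotomy i j with hij | rfl | hij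
    · rcases lt_trichotomy j k with hjk | rfl | hjk
      · simp [hij, hjk, hij.not_gt, hjk.not_gt, (hij.trans hjk).not_gt]
      · simp [h23]
      · rcases lt_trichotomy i k with hik | rfl | hik
        · simp [hij, hjk, hik, hij.not_gt, hjk.not_gt, hik.not_gt]
        · simp [h13]
        · simp [hij, hjk, hik, hij.not_gt, hjk.not_gt, hik.not_gt]
    · simp [h12]
    · rcases lt_trichotomy j k with hjk | rfl | hjk
      · rcases lt_trichotomy i k with hik | rfl | hik
        · simp [hij, hjk, hik, hij.not_gt, hjk.not_gt, hik.not_gt]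
        · simp [h13]
        · simp [hij, hjk, hik, hij.not_gt, hjk.not_gt, hik.not_gt]
      · simp [h23]
      · simp [hij, hjk, hij.not_gt, hjk.not_gt, (hjk.trans hij).not_gt]
  have merge (i j k : ι) : (if i < j ∧ j < k then
      G i j k + G i k j + G j i k + G j k i + G k i j + G k j i else 0) =
      T G i j k + T (fun i k j => G i j k) i j k
      + T (fun j i k => G i j k) i j k + T (fun j k i => G i j k) i j k
      + T (fun k i j => G i j k) i j k + T (fun k j i => G i j k) i j k := by
    simp only [T]
    split_ifs <;> ring
  simp_rw [merge]
  rw [Finset.sum_congr rfl fun i _ => Finset.sum_congr rfl fun j _ =>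
    Finset.sum_congr rfl fun k _ => split i j k]
  simp only [Finset.sum_add_distrib]
  have e2 := swap23 (T fun i k j => G i j k)
  have e3 := swap12 (T fun j i k => G i j k)
  have e4 := (swap23 (T fun j k i => G i j k)).trans
    (swap12 fun i j k => T (fun j k i => G i j k) i k j)
  have e5 := (swap12 (T fun k i j => G i j k)).trans
    (swap23 fun i j k => T (fun k i j => G i j k) j i k)
  have e6 := ((swap12 (T fun k j i => G i j k)).trans
    (swap23 fun i j k => T (fun k j i => G i j k) j i k)).trans
    (swap12 fun i j k => T (fun k j i => G i j k) k i j)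
  linarith

theorem det_three_of (a b c d e f g h i : ℝ) :
    Matrix.det !![a, b, c; d, e, f; g, h, i] =
      a * e * i - a * f * h - b * d * i + b * f * g + c * d * h - c * e * g := by
  simp [Matrix.det_fin_three]

/-- Cauchy–Binet for a `3 × n` and an `n × 3` matrix, when the first column of the product
is `(1, 0, 0)` and the first column of the second factor is constant `1`. -/
theorem det_two_eq_sum_det_three {ι : Type*} [Fintype ι] [LinearOrder ι] (p q r u v : ι → ℝ)
    (hp : ∑ i, p i = 1) (hq : ∑ i, q i = 0) (hr : ∑ i, r i = 0) :
    (∑ i, q i * u i) * (∑ i, r i * v i) - (∑ i, r i * u i) * (∑ i, q i * v i) =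
      ∑ i, ∑ j, ∑ k, if i < j ∧ j < k then
        Matrix.det !![p i, p j, p k; q i, q j, q k; r i, r j, r k] *
          Matrix.det !![1, 1, 1; u i, u j, u k; v i, v j, v k] else 0 := by
  have prod_sum (f g h : ι → ℝ) :
      (∑ i, f i) * (∑ j, g j) * (∑ k, h k) = ∑ i, ∑ j, ∑ k, f i * g j * h k := by
    rw [Finset.sum_mul_sum]
    simp only [Finset.sum_mul]
    simp only [Finset.mul_sum]
  let G (i j k : ι) : ℝ := Matrix.det !![p i, p j, p k; q i, q j, q k; r i, r j, r k] * (u j * v k)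
  have expand : ∑ i, ∑ j, ∑ k, G i j k =
      (∑ i, p i) * (∑ i, q i * u i) * (∑ i, r i * v i)
      - (∑ i, p i) * (∑ i, r i * u i) * (∑ i, q i * v i)
      - (∑ i, q i) * (∑ i, p i * u i) * (∑ i, r i * v i)
      + (∑ i, r i) * (∑ i, p i * u i) * (∑ i, q i * v i)
      + (∑ i, q i) * (∑ i, r i * u i) * (∑ i, p i * v i)
      - (∑ i, r i) * (∑ i, q i * u i) * (∑ i, p i * v i) := by
    simp only [prod_sum, ← Finset.sum_add_distrib, ← Finset.sum_sub_distrib]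
    refine Finset.sum_congr rfl fun i _ => Finset.sum_congr rfl fun j _ =>
      Finset.sum_congr rfl fun k _ => ?_
    simp only [G, det_three_of]
    ring
  rw [hp, hq, hr] at expand
  rw [sum_triple_eq_sum_increasing G (fun _ _ => ?_) (fun _ _ => ?_) (fun _ _ => ?_)] at expand
  · trans ∑ i, ∑ j, ∑ k, if i < j ∧ j < k then
        G i j k + G i k j + G j i k + G j k i + G k i j + G k j i else 0
    · linarith
    refine Finset.sum_congr rfl fun i _ => Finset.sum_congr rfl fun j _ =>
      Finset.sum_congr rfl fun k _ => ?_
    congr 1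
    simp only [G, det_three_of]
    ring
  all_goals
    simp only [G, det_three_of]
    ring

/-- If `λ₁, …, λₙ` are differentiable on an open `U ⊆ ℝ²` with `Σᵢ λᵢ ≡ 1`,
`a₁, …, aₙ ∈ ℝ²`, and `F = Σᵢ λᵢ aᵢ`, then
`det(DF(x)) = 2 Σ_{i<j<k} D(λᵢ,λⱼ,λₖ)(x) · A(aᵢ,aⱼ,aₖ)` on `U`. -/
theorem stmt_1 (n : ℕ) (U : Set E2) (hU : IsOpen U) (lam : Fin n → E2 → ℝ)
    (hdiff : ∀ i, ∀ x ∈ U, DifferentiableAt ℝ (lam i) x)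
    (hsum : ∀ x ∈ U, ∑ i, lam i x = 1)
    (a : Fin n → E2) (F : E2 → E2) (hF : ∀ x, F x = ∑ i, lam i x • a i) :
    ∀ x ∈ U,
      (jac F x).det =
        2 * ∑ i : Fin n, ∑ j : Fin n, ∑ k : Fin n,
          (if i < j ∧ j < k then Dop (lam i) (lam j) (lam k) x * areaA (a i) (a j) (a k)
           else 0) := by
  intro x hx
  have fderiv_sum (e : E2) : ∑ i, fderiv ℝ (lam i) x e = 0 := by
    have hconst : (fun y => ∑ i, lam i y) =ᶠ[nhds x] fun _ => (1 : ℝ) :=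
      Filter.eventually_of_mem (hU.mem_nhds hx) hsum
    have hderiv := hconst.fderiv_eq (𝕜 := ℝ)
    rw [fderiv_fun_sum fun i _ => hdiff i x hx] at hderiv
    simpa using congrArg (fun L : E2 →L[ℝ] ℝ => L e) hderiv
  have fderiv_coord (s : Fin 2) (e : E2) :
      fderiv ℝ (fun y => F y s) x e = ∑ i, fderiv ℝ (lam i) x e * a i s := by
    have hcoord : (fun y => F y s) = fun y => ∑ i, lam i y * a i s := by
      funext y
      simp [hF]
    rw [hcoord, fderiv_fun_sum fun i _ => (hdiff i x hx).mul_const _]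
    simp [fderiv_mul_const (hdiff _ x hx), mul_comm]
  have key := det_two_eq_sum_det_three (fun i => lam i x) _ _ (fun i => a i 0) (fun i => a i 1)
    (hsum x hx) (fderiv_sum (EuclideanSpace.single 0 1)) (fderiv_sum (EuclideanSpace.single 1 1))
  rw [Matrix.det_fin_two]
  simp only [jac, Matrix.of_apply, fderiv_coord]
  rw [key]
  simp only [Finset.mul_sum]
  refine Finset.sum_congr rfl fun i _ => Finset.sum_congr rfl fun j _ =>
    Finset.sum_congr rfl fun k _ => ?_
  split_ifs
  · simp only [Dop, areaA]
    ring
  · simp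

end
end

section
/- Let K̂ and K be compact convex subsets of ℝ² with nonempty interior, and let F : K̂ → ℝ² be a continuous map with F(K̂) ⊆ K such that the restriction of F to the topological frontier of K̂ is a homeomorphism from the frontier of K̂ onto the frontier of K. Then F is surjective onto K, i.e., F(K̂) = K. -/
noncomputable section

open Metric Set

theorem Convex.one_le_of_mem_frontier_of_sub_eq_smul {E : Type*} [NormedAddCommGroup E]
    [NormedSpace ℝ E] {K : Set E} (hK : Convex ℝ K) {p x y : E} (hp : p ∈ interior K)
    (hx : x ∈ frontier K) (hy : y ∈ frontier K) {c : ℝ} (hc : 0 < c)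
    (h : x - p = c • (y - p)) : 1 ≤ c := by
  by_contra! hlt
  refine hx.2 (hK.openSegment_interior_closure_subset_interior hp hy.1 ?_)
  refine ⟨1 - c, c, by linarith, hc, by ring, ?_⟩
  rw [← sub_add_cancel x p, h]
  module

/-- A ray from an interior point of a convex set meets the frontier at most once. -/
theorem Convex.eq_of_mem_frontier_of_sub_eq_smul {E : Type*} [NormedAddCommGroup E]
    [NormedSpace ℝ E] {K : Set E} (hK : Convex ℝ K) {p x y : E} (hp : p ∈ interior K)
    (hx : x ∈ frontier K) (hy : y ∈ frontier K) {c : ℝ} (hc : 0 < c)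
    (h : x - p = c • (y - p)) : x = y := by
  have h1 := hK.one_le_of_mem_frontier_of_sub_eq_smul hp hx hy hc h
  have h2 := hK.one_le_of_mem_frontier_of_sub_eq_smul hp hy hx (inv_pos.2 hc)
    (by rw [h, inv_smul_smul₀ hc.ne'])
  have hc1 : c = 1 := le_antisymm ((one_le_inv₀ hc).1 h2) h1
  simpa [hc1] using h

/-- The one-dimensional Borsuk–Ulam theorem on the unit sphere of a normed space. -/
theorem exists_mem_sphere_eq_neg {E : Type*} [NormedAddCommGroup E] [NormedSpace ℝ E]
    (hE : 1 < Module.rank ℝ E) {f : E → ℝ} (hf : Continuous f) :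
    ∃ x ∈ sphere (0 : E) 1, f x = f (-x) := by
  obtain ⟨a, ha⟩ := (isConnected_sphere hE 0 zero_le_one).nonempty
  have hna : -a ∈ sphere (0 : E) 1 := by simpa using ha
  have hpre := isPreconnected_sphere hE (0 : E) 1
  have hneg : Continuous fun x ↦ f (-x) := hf.comp continuous_neg
  rcases le_total (f a) (f (-a)) with h | h
  · exact hpre.intermediate_value₂ ha hna hf.continuousOn hneg.continuousOn h (by simpa using h)
  · exact hpre.intermediate_value₂ hna ha hf.continuousOn hneg.continuousOn (by simpa using h) h

/-- A nowhere vanishing continuous complex function on a normed space takes values on a common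
ray at some pair of antipodal points of the unit sphere. -/
theorem exists_mem_sphere_eq_smul_neg {E : Type*} [NormedAddCommGroup E] [NormedSpace ℝ E]
    (hE : 1 < Module.rank ℝ E) {u : E → ℂ} (hu : Continuous u) (hu0 : ∀ x, u x ≠ 0) :
    ∃ x ∈ sphere (0 : E) 1, ∃ c : ℝ, 0 < c ∧ u x = c • u (-x) := by
  obtain ⟨L, ⟨-, hL⟩, -⟩ := Complex.isCoveringMapOn_exp.existsUnique_continuousMap_lifts
    (⟨u, hu⟩ : C(E, ℂ)) (a₀ := 0) (e₀ := Complex.log (u 0)) (Complex.exp_log (hu0 0)) hu0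
  have hexp : ∀ x, u x = Complex.exp (L x) := fun x ↦ (congrFun hL x).symm
  obtain ⟨x, hx, hxL⟩ := exists_mem_sphere_eq_neg hE (Complex.continuous_im.comp L.continuous)
  refine ⟨x, hx, Real.exp ((L x).re - (L (-x)).re), Real.exp_pos _, ?_⟩
  rw [hexp, hexp, Complex.real_smul, Complex.ofReal_exp, ← Complex.exp_add]
  congr 1
  apply Complex.ext
  · simp
  · simpa using hxL

/-- Radial projection of a normed space onto its closed unit ball. -/
theorem exists_continuous_retraction_closedBall (E : Type*) [NormedAddCommGroup E]
    [NormedSpace ℝ E] :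
    ∃ r : E → E, Continuous r ∧ (∀ x, r x ∈ closedBall (0 : E) 1) ∧
      ∀ x ∈ sphere (0 : E) 1, r x = x := by
  have hpos : ∀ x : E, 0 < max 1 ‖x‖ := fun x ↦ lt_max_of_lt_left one_pos
  refine ⟨fun x ↦ (max 1 ‖x‖)⁻¹ • x, ?_, fun x ↦ ?_, fun x hx ↦ ?_⟩
  · exact ((continuous_const.max continuous_norm).inv₀ fun x ↦ (hpos x).ne').smul continuous_id
  · rw [mem_closedBall_zero_iff, norm_smul, norm_inv, Real.norm_of_nonneg (hpos x).le,
      inv_mul_le_one₀ (hpos x)]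
    exact le_max_right _ _
  · have : ‖x‖ = 1 := by simpa using hx
    simp [this]

/-- Let `K̂` and `K` be compact convex subsets of `ℝ²` with nonempty interior, and let
`F` be continuous on `K̂` with `F(K̂) ⊆ K`, whose restriction to the frontier of `K̂` is a
homeomorphism onto the frontier of `K` (equivalently, since the frontier of `K̂` is compact:
a continuous bijection from `frontier K̂` onto `frontier K`). Then `F(K̂) = K`. -/
theorem stmt_2 (Khat K : Set E2) (hKhatComp : IsCompact Khat) (hKComp : IsCompact K)
    (hKhatConv : Convex ℝ Khat) (hKConv : Convex ℝ K)
    (hKhatInt : (interior Khat).Nonempty) (hKInt : (interior K).Nonempty)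
    (F : E2 → E2) (hFcont : ContinuousOn F Khat) (hFK : F '' Khat ⊆ K)
    (hFfrontier : Set.BijOn F (frontier Khat) (frontier K)) :
    F '' Khat = K := by
  refine hFK.antisymm fun p hp ↦ ?_
  by_contra hpF
  have hpint : p ∈ interior K := by
    by_contra hpi
    obtain ⟨x, hx, rfl⟩ := hFfrontier.surjOn ⟨subset_closure hp, hpi⟩
    exact hpF ⟨x, hKhatComp.isClosed.frontier_subset hx, rfl⟩
  obtain ⟨h, -, hball, hsphere⟩ :=
    exists_homeomorph_image_interior_closure_frontier_eq_unitBall hKhatConv hKhatInt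
      hKhatComp.isBounded
  rw [hKhatComp.isClosed.closure_eq] at hball
  obtain ⟨r, hr, hrball, hrsphere⟩ := exists_continuous_retraction_closedBall E2
  have hmem : ∀ x, h.symm (r x) ∈ Khat := fun x ↦ by
    obtain ⟨y, hy, hyx⟩ := hball ▸ hrball x
    rwa [← hyx, h.symm_apply_apply]
  have hfront : ∀ x ∈ sphere (0 : E2) 1, h.symm (r x) ∈ frontier Khat := fun x hx ↦ by
    obtain ⟨y, hy, hyx⟩ := hsphere ▸ hx
    rwa [hrsphere x hx, ← hyx, h.symm_apply_apply]
  have hG : Continuous fun x ↦ F (h.symm (r x)) :=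
    hFcont.comp_continuous (h.symm.continuous.comp hr) hmem
  let e := Complex.orthonormalBasisOneI.repr.symm
  obtain ⟨x, hx, c, hc, hxc⟩ := exists_mem_sphere_eq_smul_neg (E := E2)
    (u := fun x ↦ e (F (h.symm (r x)) - p))
    (by rw [← Module.finrank_eq_rank, finrank_euclideanSpace_fin]; norm_num)
    (e.continuous.comp (hG.sub continuous_const))
    (fun x hx ↦ hpF ⟨_, hmem x, sub_eq_zero.1 (e.map_eq_zero_iff.1 hx)⟩)
  have hnx : -x ∈ sphere (0 : E2) 1 := by simpa using hx
  rw [← map_smul] at hxc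
  have hFeq := hKConv.eq_of_mem_frontier_of_sub_eq_smul hpint
    (hFfrontier.mapsTo (hfront x hx)) (hFfrontier.mapsTo (hfront (-x) hnx)) hc (e.injective hxc)
  have hxx := h.symm.injective (hFfrontier.injOn (hfront x hx) (hfront (-x) hnx) hFeq)
  rw [hrsphere x hx, hrsphere (-x) hnx, eq_neg_iff_add_eq_zero, ← two_smul ℝ,
    smul_eq_zero_iff_right two_ne_zero] at hxx
  simp [hxx] at hx

end
end

section
/- Let U ⊆ ℝ² be open, let λ₁, …, λₙ : U → ℝ be differentiable with Σ_{i=1}^n λ_i(x) = 1 and ‖∇λ_i(x)‖ ≤ Ĉ for all x ∈ U and all i, and let a₁, …, aₙ ∈ ℝ² satisfy ‖a_i − a_j‖ ≤ h for all i, j. Define F : U → ℝ² by F(x) = Σ_{i=1}^n λ_i(x) a_i. Then for every x ∈ U, the operator norm of the Jacobian satisfies ‖DF(x)‖₂ ≤ 2(n−1) Ĉ h. -/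
noncomputable section

/-- If the derivatives of the weights sum to zero, the base point `b` may be subtracted from every
vector in the derivative of `∑ i, f i y • a i`. -/
theorem fderiv_sum_smul_const_eq_sum_smulRight_sub {ι E G : Type*} [Fintype ι]
    [NormedAddCommGroup E] [NormedSpace ℝ E] [NormedAddCommGroup G] [NormedSpace ℝ G]
    {f : ι → E → ℝ} {x : E} (hf : ∀ i, DifferentiableAt ℝ (f i) x)
    (hsum : ∑ i, fderiv ℝ (f i) x = 0) (a : ι → G) (b : G) :
    fderiv ℝ (fun y => ∑ i, f i y • a i) x =
      ∑ i, (fderiv ℝ (f i) x).smulRight (a i - b) := by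
  have hF : HasFDerivAt (fun y => ∑ i, f i y • a i)
      (∑ i, (fderiv ℝ (f i) x).smulRight (a i)) x :=
    HasFDerivAt.fun_sum fun i _ => (hf i).hasFDerivAt.smul_const (a i)
  rw [hF.fderiv]
  ext v
  have hv : ∑ i, fderiv ℝ (f i) x v = 0 := by
    simpa using congrArg (fun L => L v) hsum
  simp [smul_sub, Finset.sum_sub_distrib, ← Finset.sum_smul, hv]

theorem norm_fderiv_eq_norm_gradient {E : Type*} [NormedAddCommGroup E] [InnerProductSpace ℝ E]
    [CompleteSpace E] (f : E → ℝ) (x : E) : ‖fderiv ℝ f x‖ = ‖gradient f x‖ :=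
  ((InnerProductSpace.toDual ℝ E).symm.norm_map _).symm

/-- Let `λ₁, …, λₙ` be differentiable on an open `U ⊆ ℝ²` with `Σᵢ λᵢ ≡ 1` and
`‖∇λᵢ‖ ≤ Ĉ` on `U`, and `a₁, …, aₙ ∈ ℝ²` with `‖aᵢ − aⱼ‖ ≤ h`. Then the operator norm
(induced by the Euclidean norm) of the Jacobian of `F = Σᵢ λᵢ aᵢ` satisfies
`‖DF(x)‖₂ ≤ 2(n−1) Ĉ h` on `U`. -/
theorem stmt_7 (n : ℕ) (U : Set E2) (hU : IsOpen U) (Chat h : ℝ)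
    (lam : Fin n → E2 → ℝ)
    (hdiff : ∀ i, ∀ x ∈ U, DifferentiableAt ℝ (lam i) x)
    (hsum : ∀ x ∈ U, ∑ i, lam i x = 1)
    (hgrad : ∀ i, ∀ x ∈ U, ‖gradient (lam i) x‖ ≤ Chat)
    (a : Fin n → E2) (hsep : ∀ i j, ‖a i - a j‖ ≤ h) :
    ∀ x ∈ U, ‖fderiv ℝ (fun y => ∑ i, lam i y • a i) x‖ ≤ 2 * ((n : ℝ) - 1) * Chat * h := by
  intro x hx
  obtain _ | m := n
  · simpa using hsum x hx
  have hC : 0 ≤ Chat := (norm_nonneg _).trans (hgrad 0 x hx)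
  have hh : 0 ≤ h := (norm_nonneg _).trans (hsep 0 0)
  have hzero : ∑ i, fderiv ℝ (lam i) x = 0 := by
    rw [← fderiv_fun_sum fun i _ => hdiff i x hx]
    have hconst : (fun y => ∑ i, lam i y) =ᶠ[nhds x] fun _ => (1 : ℝ) :=
      Filter.eventually_of_mem (hU.mem_nhds hx) hsum
    rw [hconst.fderiv_eq, fderiv_fun_const, Pi.zero_apply]
  rw [fderiv_sum_smul_const_eq_sum_smulRight_sub (fun i => hdiff i x hx) hzero a (a 0),
    Fin.sum_univ_succ, sub_self, ContinuousLinearMap.smulRight_zero, zero_add]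
  have hterm (i : Fin m) :
      ‖(fderiv ℝ (lam i.succ) x).smulRight (a i.succ - a 0)‖ ≤ Chat * h := by
    rw [ContinuousLinearMap.norm_smulRight_apply, norm_fderiv_eq_norm_gradient]
    exact mul_le_mul (hgrad _ x hx) (hsep _ _) (norm_nonneg _) hC
  calc _ ≤ ∑ _i : Fin m, Chat * h := norm_sum_le_of_le _ fun i _ => hterm i
    _ = m * (Chat * h) := by simp
    _ ≤ 2 * (((m + 1 : ℕ) : ℝ) - 1) * Chat * h := by
      push_cast
      linarith [mul_nonneg m.cast_nonneg (mul_nonneg hC hh)]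

end
end

section
/- Let n ≥ 3 be an integer, h > 0, 0 < C₂ ≤ 1, 0 < c_M ≤ 1. Let λ₁, …, λₙ ≥ 0 be reals with Σ_{k=1}^n λ_k = 1; let (h_{jk})_{1≤j,k≤n} be reals with 0 ≤ h_{jk} ≤ h for all j, k, and h_{jk} ≥ C₂ h whenever k ∉ {j, j+1 (mod n)}; and let M₁, …, Mₙ be reals with c_M ≤ M_i ≤ 1. Define ĥ_j := Σ_{k=1}^n λ_k h_{jk}, ŵ_i := M_i ∏_{j∉{i−1,i (mod n)}} ĥ_j, and Ŵ := Σ_{i=1}^n ŵ_i. Then for every i: c_M (C₂ λ_i h)^{n−2} ≤ ŵ_i ≤ h^{n−2}, and moreover c_M C₂^{n−2} n^{3−n} h^{n−2} ≤ Ŵ ≤ n h^{n−2}. -/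
noncomputable section

theorem sum_pow_ge_of_sum_eq_one {n : ℕ} (hn : 3 ≤ n) (lam : Fin n → ℝ)
    (hlam : ∀ k, 0 ≤ lam k) (hlamsum : ∑ k, lam k = 1) :
    (n : ℝ) ^ ((3 : ℤ) - (n : ℤ)) ≤ ∑ i, lam i ^ (n - 2) := by
  have key := pow_sum_div_card_le_sum_pow (s := Finset.univ) (f := lam)
    (fun i _ => hlam i) (n - 3)
  have hexp : n - 3 + 1 = n - 2 := by omega
  rw [hexp, hlamsum, one_pow, Finset.card_univ, Fintype.card_fin] at key
  have hz : (3 : ℤ) - (n : ℤ) = -((n - 3 : ℕ) : ℤ) := by omega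
  rwa [hz, zpow_neg, zpow_natCast, ← one_div]

theorem card_filter_ne_sub_one_and_ne {n : ℕ} [NeZero n] (hn : 2 ≤ n) (i : Fin n) :
    (Finset.univ.filter (fun j : Fin n => j ≠ i - 1 ∧ j ≠ i)).card = n - 2 := by
  have hne : i - 1 ≠ i := by
    simp
    omega
  have hset : Finset.univ.filter (fun j : Fin n => j ≠ i - 1 ∧ j ≠ i) = {i - 1, i}ᶜ := by
    ext j
    simp
  rw [hset, Finset.card_compl, Finset.card_pair hne, Fintype.card_fin]

/-- Bounds on the pullbacks of the Wachspress weights (Lemma on `Ŵ`): with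
`ĥⱼ = Σₖ λₖ h_{jk}`, `ŵᵢ = Mᵢ ∏_{j∉{i−1,i}} ĥⱼ`, `Ŵ = Σᵢ ŵᵢ`, one has
`c_M (C₂ λᵢ h)^{n−2} ≤ ŵᵢ ≤ h^{n−2}` and
`c_M C₂^{n−2} n^{3−n} h^{n−2} ≤ Ŵ ≤ n h^{n−2}`. -/
theorem stmt_13 (n : ℕ) [NeZero n] (hn : 3 ≤ n) (h C₂ cM : ℝ) (hh : 0 < h)
    (hC₂0 : 0 < C₂) (hC₂1 : C₂ ≤ 1) (hcM0 : 0 < cM) (hcM1 : cM ≤ 1)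
    (lam : Fin n → ℝ) (hlam : ∀ k, 0 ≤ lam k) (hlamsum : ∑ k, lam k = 1)
    (hjk : Fin n → Fin n → ℝ)
    (hjk0 : ∀ j k, 0 ≤ hjk j k) (hjkh : ∀ j k, hjk j k ≤ h)
    (hjklow : ∀ j k : Fin n, k ≠ j → k ≠ j + 1 → C₂ * h ≤ hjk j k)
    (M : Fin n → ℝ) (hM0 : ∀ i, cM ≤ M i) (hM1 : ∀ i, M i ≤ 1) :
    (∀ i : Fin n,
      cM * (C₂ * lam i * h) ^ (n - 2) ≤
        M i * ∏ j ∈ Finset.univ.filter (fun j : Fin n => j ≠ i - 1 ∧ j ≠ i),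
          (∑ k, lam k * hjk j k) ∧
      M i * ∏ j ∈ Finset.univ.filter (fun j : Fin n => j ≠ i - 1 ∧ j ≠ i),
          (∑ k, lam k * hjk j k) ≤ h ^ (n - 2)) ∧
    cM * C₂ ^ (n - 2) * (n : ℝ) ^ ((3 : ℤ) - (n : ℤ)) * h ^ (n - 2) ≤
      (∑ i : Fin n, M i * ∏ j ∈ Finset.univ.filter (fun j : Fin n => j ≠ i - 1 ∧ j ≠ i),
        (∑ k, lam k * hjk j k)) ∧
    (∑ i : Fin n, M i * ∏ j ∈ Finset.univ.filter (fun j : Fin n => j ≠ i - 1 ∧ j ≠ i),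
        (∑ k, lam k * hjk j k)) ≤ (n : ℝ) * h ^ (n - 2) := by
  have hhat_nonneg (j : Fin n) : 0 ≤ ∑ k, lam k * hjk j k :=
    Finset.sum_nonneg fun k _ => mul_nonneg (hlam k) (hjk0 j k)
  have hhat_le (j : Fin n) : ∑ k, lam k * hjk j k ≤ h := by
    calc ∑ k, lam k * hjk j k ≤ ∑ k, lam k * h :=
          Finset.sum_le_sum fun k _ => mul_le_mul_of_nonneg_left (hjkh j k) (hlam k)
      _ = h := by rw [← Finset.sum_mul, hlamsum, one_mul]
  have le_hhat (i j : Fin n) (hj : j ≠ i - 1 ∧ j ≠ i) :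
      C₂ * lam i * h ≤ ∑ k, lam k * hjk j k := by
    have hij : i ≠ j + 1 := fun e => hj.1 (by rw [e, add_sub_cancel_right])
    calc C₂ * lam i * h = lam i * (C₂ * h) := by ring
      _ ≤ lam i * hjk j i := mul_le_mul_of_nonneg_left (hjklow j i hj.2.symm hij) (hlam i)
      _ ≤ ∑ k, lam k * hjk j k :=
          Finset.single_le_sum (f := fun k => lam k * hjk j k)
            (fun k _ => mul_nonneg (hlam k) (hjk0 j k)) (Finset.mem_univ i)
  have card_eq (i : Fin n) := card_filter_ne_sub_one_and_ne (by omega : 2 ≤ n) i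
  have lower (i : Fin n) : cM * (C₂ * lam i * h) ^ (n - 2) ≤
      M i * ∏ j ∈ Finset.univ.filter (fun j : Fin n => j ≠ i - 1 ∧ j ≠ i),
        (∑ k, lam k * hjk j k) := by
    have hbase : 0 ≤ C₂ * lam i * h := mul_nonneg (mul_nonneg hC₂0.le (hlam i)) hh.le
    refine mul_le_mul (hM0 i) ?_ (pow_nonneg hbase _) (hcM0.le.trans (hM0 i))
    rw [← card_eq i, ← Finset.prod_const]
    exact Finset.prod_le_prod (fun _ _ => hbase) fun j hj =>
      le_hhat i j (Finset.mem_filter.mp hj).2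
  have upper (i : Fin n) :
      M i * ∏ j ∈ Finset.univ.filter (fun j : Fin n => j ≠ i - 1 ∧ j ≠ i),
        (∑ k, lam k * hjk j k) ≤ h ^ (n - 2) := by
    refine (mul_le_of_le_one_left (Finset.prod_nonneg fun j _ => hhat_nonneg j) (hM1 i)).trans ?_
    rw [← card_eq i, ← Finset.prod_const]
    exact Finset.prod_le_prod (fun j _ => hhat_nonneg j) fun j _ => hhat_le j
  refine ⟨fun i => ⟨lower i, upper i⟩, ?_, ?_⟩
  · calc cM * C₂ ^ (n - 2) * (n : ℝ) ^ ((3 : ℤ) - (n : ℤ)) * h ^ (n - 2)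
        ≤ cM * C₂ ^ (n - 2) * (∑ i, lam i ^ (n - 2)) * h ^ (n - 2) := by
          gcongr
          exact sum_pow_ge_of_sum_eq_one hn lam hlam hlamsum
      _ = ∑ i, cM * (C₂ * lam i * h) ^ (n - 2) := by
          rw [Finset.mul_sum, Finset.sum_mul]
          exact Finset.sum_congr rfl fun i _ => by rw [mul_pow, mul_pow]; ring
      _ ≤ _ := Finset.sum_le_sum fun i _ => lower i
  · refine (Finset.sum_le_sum fun i _ => upper i).trans_eq ?_
    simp

end
end
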